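/- arXiv:1708.01849 — 2 statements merged into one kernel-verified Lean document; each statement's English description precedes it below -/
import Mathlib

section
/- For every nonnegative integer n and every m ∈ {35, 40, 50, 55}, there exists a near-modular set modulo 10·3^{n+1} whose maximum element is m·3^n. -/
/-- `z` is mod-covered by `A` modulo `N`. -/
def ModCovered (N : ℕ) (A : Set ℕ) (z : ℤ) : Prop :=
  ∃ x ∈ A, ∃ y ∈ A, x ≤ y ∧ 2 * (y : ℤ) - (x : ℤ) ≡ z [ZMOD (N : ℤ)]

/-- `A` is 3-free modulo `N`: any mod-AP in `A` is trivial. -/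
def ThreeFreeMod (N : ℕ) (A : Set ℕ) : Prop :=
  ∀ x ∈ A, ∀ y ∈ A, ∀ z ∈ A,
    ((x : ℤ) + (z : ℤ) ≡ 2 * (y : ℤ) [ZMOD (N : ℤ)]) → x = y ∧ y = z

/-- `A` is a near-modular set modulo `N`. -/
def NearModular (N : ℕ) (A : Finset ℕ) : Prop :=
  0 ∈ A ∧ ThreeFreeMod N ↑A ∧ ∀ z : ℤ, ModCovered N ↑A z

/-- `A` is a modular set modulo `N`: near-modular and contained in `{0, …, N-1}`. -/
def ModularSet (N : ℕ) (A : Finset ℕ) : Prop :=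
  NearModular N A ∧ ∀ a ∈ A, a < N

/-- The set whose residue classes `0` and `1` modulo `3` are copies of `A` and `B`. -/
def ternaryLift (A B : Finset ℕ) : Finset ℕ :=
  A.image (fun a => 3 * a) ∪ B.image (fun b => 3 * b + 1)

theorem mem_ternaryLift {A B : Finset ℕ} {x : ℕ} :
    x ∈ ternaryLift A B ↔ (∃ a ∈ A, x = 3 * a) ∨ ∃ b ∈ B, x = 3 * b + 1 := by
  simp [ternaryLift, eq_comm]

theorem three_mul_mem_ternaryLift {A B : Finset ℕ} {a : ℕ} (ha : a ∈ A) :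
    3 * a ∈ ternaryLift A B :=
  mem_ternaryLift.2 (.inl ⟨a, ha, rfl⟩)

theorem three_mul_add_one_mem_ternaryLift {A B : Finset ℕ} {b : ℕ} (hb : b ∈ B) :
    3 * b + 1 ∈ ternaryLift A B :=
  mem_ternaryLift.2 (.inr ⟨b, hb, rfl⟩)

theorem ThreeFreeMod.ternaryLift {N : ℕ} {A B : Finset ℕ} (hA : ThreeFreeMod N ↑A)
    (hB : ThreeFreeMod N ↑B) : ThreeFreeMod (3 * N) ↑(ternaryLift A B) := by
  intro x hx y hy z hz h
  obtain ⟨k, hk⟩ := h.dvd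
  push_cast at hk
  rw [mul_assoc] at hk
  rcases mem_ternaryLift.1 hx with ⟨a, ha, rfl⟩ | ⟨a, ha, rfl⟩ <;>
  rcases mem_ternaryLift.1 hy with ⟨b, hb, rfl⟩ | ⟨b, hb, rfl⟩ <;>
  rcases mem_ternaryLift.1 hz with ⟨c, hc, rfl⟩ | ⟨c, hc, rfl⟩ <;>
  push_cast at hk <;> try omega
  · obtain ⟨rfl, rfl⟩ := hA a ha b hb c hc
      (Int.modEq_iff_dvd.2 ⟨k, by linarith⟩)
    exact ⟨rfl, rfl⟩
  · obtain ⟨rfl, rfl⟩ := hB a ha b hb c hc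
      (Int.modEq_iff_dvd.2 ⟨k, by linarith⟩)
    exact ⟨rfl, rfl⟩

theorem modEq_three_mul_add {N : ℕ} {u v z r w : ℤ} (h : u ≡ v [ZMOD (N : ℤ)])
    (hw : w = 3 * u + r) (hz : z = 3 * v + r) : w ≡ z [ZMOD ((3 * N : ℕ) : ℤ)] := by
  subst hw hz
  push_cast
  exact h.mul_left'.add_right r

theorem exists_eq_three_mul_add (z : ℤ) :
    ∃ v : ℤ, z = 3 * v + 0 ∨ z = 3 * v + 1 ∨ z = 3 * v + 2 :=
  ⟨z / 3, by omega⟩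

/-- The hypotheses on `(A, B)` that pass to `(ternaryLift A B, ternaryLift B B)` and make
`ternaryLift A B` near-modular. -/
structure LiftablePair (N m : ℕ) (A B : Finset ℕ) : Prop where
  nearModular : NearModular N A
  mem_max : m ∈ A
  le_max : ∀ a ∈ A, a ≤ m
  lt_max : ∀ b ∈ B, b < m
  threeFree : ThreeFreeMod N ↑B
  covered : ∀ z : ℤ, ModCovered N ↑B z
  /-- Covers the residue class `2` modulo `3` of `ternaryLift A B`. -/
  cross : ∀ z : ℤ, ∃ a ∈ A, ∃ b ∈ B,
    (a ≤ b ∧ 2 * (b : ℤ) - a ≡ z [ZMOD (N : ℤ)]) ∨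
    (b < a ∧ 2 * (a : ℤ) - b - 1 ≡ z [ZMOD (N : ℤ)])
  /-- Supplies the class `0` modulo `3` of `cross` after lifting. -/
  strict : ∀ z : ℤ, ∃ b ∈ B,
    (∃ c ∈ B, c < b ∧ 2 * (b : ℤ) - c ≡ z [ZMOD (N : ℤ)]) ∨
    (∃ a ∈ A, a ≤ b ∧ 2 * (b : ℤ) - a ≡ z [ZMOD (N : ℤ)])

theorem ModCovered.ternaryLift {N : ℕ} {A B : Finset ℕ}
    (hA : ∀ z : ℤ, ModCovered N ↑A z) (hB : ∀ z : ℤ, ModCovered N ↑B z)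
    (hAB : ∀ z : ℤ, ∃ a ∈ A, ∃ b ∈ B,
      (a ≤ b ∧ 2 * (b : ℤ) - a ≡ z [ZMOD (N : ℤ)]) ∨
      (b < a ∧ 2 * (a : ℤ) - b - 1 ≡ z [ZMOD (N : ℤ)])) (z : ℤ) :
    ModCovered (3 * N) ↑(ternaryLift A B) z := by
  obtain ⟨v, hz | hz | hz⟩ := exists_eq_three_mul_add z
  · obtain ⟨x, hx, y, hy, hxy, h⟩ := hA v
    exact ⟨3 * x, three_mul_mem_ternaryLift hx, 3 * y, three_mul_mem_ternaryLift hy, by omega,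
      modEq_three_mul_add h (by push_cast; ring) hz⟩
  · obtain ⟨x, hx, y, hy, hxy, h⟩ := hB v
    exact ⟨3 * x + 1, three_mul_add_one_mem_ternaryLift hx, 3 * y + 1,
      three_mul_add_one_mem_ternaryLift hy, by omega,
      modEq_three_mul_add h (by push_cast; ring) hz⟩
  · obtain ⟨a, ha, b, hb, ⟨hab, h⟩ | ⟨hab, h⟩⟩ := hAB v
    · exact ⟨3 * a, three_mul_mem_ternaryLift ha, 3 * b + 1,
        three_mul_add_one_mem_ternaryLift hb, by omega,
        modEq_three_mul_add h (by push_cast; ring) hz⟩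
    · exact ⟨3 * b + 1, three_mul_add_one_mem_ternaryLift hb, 3 * a,
        three_mul_mem_ternaryLift ha, by omega,
        modEq_three_mul_add h (by push_cast; ring) hz⟩

theorem LiftablePair.lift {N m : ℕ} {A B : Finset ℕ} (h : LiftablePair N m A B) :
    LiftablePair (3 * N) (3 * m) (ternaryLift A B) (ternaryLift B B) where
  nearModular := ⟨three_mul_mem_ternaryLift h.nearModular.1,
    h.nearModular.2.1.ternaryLift h.threeFree,
    ModCovered.ternaryLift h.nearModular.2.2 h.covered h.cross⟩
  mem_max := three_mul_mem_ternaryLift h.mem_max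
  le_max x hx := by
    rcases mem_ternaryLift.1 hx with ⟨a, ha, rfl⟩ | ⟨b, hb, rfl⟩
    · have := h.le_max a ha
      omega
    · have := h.lt_max b hb
      omega
  lt_max x hx := by
    rcases mem_ternaryLift.1 hx with ⟨b, hb, rfl⟩ | ⟨b, hb, rfl⟩ <;>
    · have := h.lt_max b hb
      omega
  threeFree := h.threeFree.ternaryLift h.threeFree
  covered := ModCovered.ternaryLift h.covered h.covered fun z => by
    obtain ⟨x, hx, y, hy, hxy, hz⟩ := h.covered z
    exact ⟨x, hx, y, hy, .inl ⟨hxy, hz⟩⟩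
  cross z := by
    obtain ⟨v, hz | hz | hz⟩ := exists_eq_three_mul_add z
    · obtain ⟨b, hb, ⟨c, hc, hcb, hv⟩ | ⟨a, ha, hab, hv⟩⟩ := h.strict v
      · exact ⟨3 * b + 1, three_mul_add_one_mem_ternaryLift hb, 3 * c + 1,
          three_mul_add_one_mem_ternaryLift hc, .inr ⟨by omega,
          modEq_three_mul_add hv (by push_cast; ring) hz⟩⟩
      · exact ⟨3 * a, three_mul_mem_ternaryLift ha, 3 * b, three_mul_mem_ternaryLift hb,
          .inl ⟨by omega, modEq_three_mul_add hv (by push_cast; ring) hz⟩⟩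
    · obtain ⟨x, hx, y, hy, hxy, hv⟩ := h.covered v
      exact ⟨3 * x + 1, three_mul_add_one_mem_ternaryLift hx, 3 * y + 1,
        three_mul_add_one_mem_ternaryLift hy, .inl ⟨by omega,
        modEq_three_mul_add hv (by push_cast; ring) hz⟩⟩
    · obtain ⟨a, ha, b, hb, ⟨hab, hv⟩ | ⟨hab, hv⟩⟩ := h.cross v
      · exact ⟨3 * a, three_mul_mem_ternaryLift ha, 3 * b + 1,
          three_mul_add_one_mem_ternaryLift hb, .inl ⟨by omega,
          modEq_three_mul_add hv (by push_cast; ring) hz⟩⟩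
      · exact ⟨3 * a, three_mul_mem_ternaryLift ha, 3 * b, three_mul_mem_ternaryLift hb,
          .inr ⟨by omega, modEq_three_mul_add hv (by push_cast; ring) hz⟩⟩
  strict z := by
    obtain ⟨v, hz | hz | hz⟩ := exists_eq_three_mul_add z
    · obtain ⟨b, hb, ⟨c, hc, hcb, hv⟩ | ⟨a, ha, hab, hv⟩⟩ := h.strict v
      · exact ⟨3 * b, three_mul_mem_ternaryLift hb, .inl ⟨3 * c, three_mul_mem_ternaryLift hc,
          by omega, modEq_three_mul_add hv (by push_cast; ring) hz⟩⟩
      · exact ⟨3 * b, three_mul_mem_ternaryLift hb, .inr ⟨3 * a, three_mul_mem_ternaryLift ha,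
          by omega, modEq_three_mul_add hv (by push_cast; ring) hz⟩⟩
    · obtain ⟨x, hx, y, hy, hxy, hv⟩ := h.covered v
      exact ⟨3 * y + 1, three_mul_add_one_mem_ternaryLift hy, .inr ⟨3 * x + 1,
        three_mul_add_one_mem_ternaryLift hx, by omega,
        modEq_three_mul_add hv (by push_cast; ring) hz⟩⟩
    · obtain ⟨x, hx, y, hy, hxy, hv⟩ := h.covered v
      exact ⟨3 * y + 1, three_mul_add_one_mem_ternaryLift hy, .inl ⟨3 * x,
        three_mul_mem_ternaryLift hx, by omega,
        modEq_three_mul_add hv (by push_cast; ring) hz⟩⟩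

theorem LiftablePair.exists_iterate {N m : ℕ} {A B : Finset ℕ} (h : LiftablePair N m A B)
    (n : ℕ) : ∃ A' B' : Finset ℕ, LiftablePair (3 ^ n * N) (3 ^ n * m) A' B' := by
  induction n with
  | zero => exact ⟨A, B, by simpa using h⟩
  | succ n ih =>
    obtain ⟨A', B', h'⟩ := ih
    refine ⟨ternaryLift A' B', ternaryLift B' B', ?_⟩
    rw [pow_succ', mul_assoc, mul_assoc]
    exact h'.lift

theorem forall_int_of_forall_lt {N : ℕ} (hN : 0 < N) {p : ℤ → Prop}
    (hp : ∀ {y z : ℤ}, y ≡ z [ZMOD (N : ℤ)] → p y → p z) (h : ∀ r < N, p (r : ℤ)) (z : ℤ) :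
    p z := by
  have hN' : (0 : ℤ) < N := by exact_mod_cast hN
  have h0 := Int.emod_nonneg z hN'.ne'
  have h1 := Int.emod_lt_of_pos z hN'
  refine hp (y := ((z % N).toNat : ℤ)) ?_ (h _ (by omega))
  rw [Int.toNat_of_nonneg h0]
  exact Int.mod_modEq z N

/-- A form of `LiftablePair` that is decidable by finite checking. -/
theorem LiftablePair.of_forall_lt {N m : ℕ} {A B : Finset ℕ} (hN : 0 < N) (h0 : 0 ∈ A)
    (hm : m ∈ A) (hA : ∀ a ∈ A, a ≤ m) (hB : ∀ b ∈ B, b < m)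
    (hfA : ∀ x ∈ A, ∀ y ∈ A, ∀ z ∈ A,
      (x : ℤ) + (z : ℤ) ≡ 2 * (y : ℤ) [ZMOD (N : ℤ)] → x = y ∧ y = z)
    (hfB : ∀ x ∈ B, ∀ y ∈ B, ∀ z ∈ B,
      (x : ℤ) + (z : ℤ) ≡ 2 * (y : ℤ) [ZMOD (N : ℤ)] → x = y ∧ y = z)
    (hcA : ∀ r < N, ∃ x ∈ A, ∃ y ∈ A, x ≤ y ∧ 2 * (y : ℤ) - x ≡ (r : ℤ) [ZMOD (N : ℤ)])
    (hcB : ∀ r < N, ∃ x ∈ B, ∃ y ∈ B, x ≤ y ∧ 2 * (y : ℤ) - x ≡ (r : ℤ) [ZMOD (N : ℤ)])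
    (hcross : ∀ r < N, ∃ a ∈ A, ∃ b ∈ B,
      (a ≤ b ∧ 2 * (b : ℤ) - a ≡ (r : ℤ) [ZMOD (N : ℤ)]) ∨
      (b < a ∧ 2 * (a : ℤ) - b - 1 ≡ (r : ℤ) [ZMOD (N : ℤ)]))
    (hstrict : ∀ r < N, ∃ b ∈ B,
      (∃ c ∈ B, c < b ∧ 2 * (b : ℤ) - c ≡ (r : ℤ) [ZMOD (N : ℤ)]) ∨
      (∃ a ∈ A, a ≤ b ∧ 2 * (b : ℤ) - a ≡ (r : ℤ) [ZMOD (N : ℤ)])) :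
    LiftablePair N m A B where
  nearModular := ⟨h0, hfA, forall_int_of_forall_lt hN
    (fun hyz ⟨x, hx, y, hy, hxy, h⟩ => ⟨x, hx, y, hy, hxy, h.trans hyz⟩) hcA⟩
  mem_max := hm
  le_max := hA
  lt_max := hB
  threeFree := hfB
  covered := forall_int_of_forall_lt hN
    (fun hyz ⟨x, hx, y, hy, hxy, h⟩ => ⟨x, hx, y, hy, hxy, h.trans hyz⟩) hcB
  cross := forall_int_of_forall_lt hN
    (fun hyz ⟨a, ha, b, hb, h⟩ => ⟨a, ha, b, hb,
      h.imp (And.imp_right (·.trans hyz)) (And.imp_right (·.trans hyz))⟩) hcross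
  strict := forall_int_of_forall_lt hN
    (fun hyz ⟨b, hb, h⟩ => ⟨b, hb,
      h.imp (fun ⟨c, hc, hcb, h⟩ => ⟨c, hc, hcb, h.trans hyz⟩)
        (fun ⟨a, ha, hab, h⟩ => ⟨a, ha, hab, h.trans hyz⟩)⟩) hstrict

theorem liftablePair_thirty_thirtyFive :
    LiftablePair 30 35 {0, 3, 11, 14, 21, 24, 32, 35} {11, 12, 14, 15, 21, 24, 25, 32} := by
  apply LiftablePair.of_forall_lt <;> decide +kernel

theorem liftablePair_thirty_forty :
    LiftablePair 30 40 {0, 3, 4, 11, 23, 24, 31, 40} {6, 7, 9, 10, 27, 28, 30, 31} := by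
  apply LiftablePair.of_forall_lt <;> decide +kernel

theorem liftablePair_thirty_fifty :
    LiftablePair 30 50 {0, 1, 4, 24, 33, 41, 43, 50} {2, 5, 23, 24, 26, 27, 45, 48} := by
  apply LiftablePair.of_forall_lt <;> decide +kernel

theorem liftablePair_thirty_fiftyFive :
    LiftablePair 30 55 {0, 1, 3, 4, 21, 22, 24, 55} {0, 10, 13, 23, 31, 34, 41, 44} := by
  apply LiftablePair.of_forall_lt <;> decide +kernel

theorem LiftablePair.exists_nearModular {m : ℕ} {A B : Finset ℕ} (h : LiftablePair 30 m A B)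
    (n : ℕ) : ∃ A : Finset ℕ, ∃ hA : A.Nonempty,
      NearModular (10 * 3 ^ (n + 1)) A ∧ A.max' hA = m * 3 ^ n := by
  obtain ⟨A', B', h'⟩ := h.exists_iterate n
  rw [show 10 * 3 ^ (n + 1) = 3 ^ n * 30 by ring, mul_comm m]
  exact ⟨A', ⟨_, h'.mem_max⟩, h'.nearModular,
    le_antisymm (Finset.max'_le _ _ _ h'.le_max) (Finset.le_max' _ _ h'.mem_max)⟩

theorem nearModular_exceptional_family (n : ℕ) (m : ℕ)
    (hm : m ∈ ({35, 40, 50, 55} : Set ℕ)) :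
    ∃ A : Finset ℕ, ∃ h : A.Nonempty,
      NearModular (10 * 3 ^ (n + 1)) A ∧ A.max' h = m * 3 ^ n := by
  rcases hm with rfl | rfl | rfl | rfl
  · exact liftablePair_thirty_thirtyFive.exists_nearModular n
  · exact liftablePair_thirty_forty.exists_nearModular n
  · exact liftablePair_thirty_fifty.exists_nearModular n
  · exact liftablePair_thirty_fiftyFive.exists_nearModular n
end

section
/- For every integer n ≥ 1, the maximum element of T_n equals 7·(9^n − 1)/8 = Σ_{i=0}^{2n−1} a_i·3^i where a_i = 1 for i even and a_i = 2 for i odd; moreover, T_n contains no element x satisfying 7·(9^n − 1)/8 − 2·3^{2n−1} < x < 2·3^{2n−1}. -/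
/-- `T 0 = {0}` and `T (n+1) = {0, 1, 6, 7} + 9 · T n`. -/
def Tset : ℕ → Finset ℕ
  | 0 => {0}
  | n + 1 => Finset.image₂ (fun d x => d + 9 * x) ({0, 1, 6, 7} : Finset ℕ) (Tset n)

theorem mem_Tset_succ {n y : ℕ} :
    y ∈ Tset (n + 1) ↔ ∃ d ∈ ({0, 1, 6, 7} : Finset ℕ), ∃ x ∈ Tset n, d + 9 * x = y := by
  simp only [Tset, Finset.mem_image₂]

theorem Tset_le {n x : ℕ} (hx : x ∈ Tset n) : 8 * x + 7 ≤ 7 * 9 ^ n := by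
  induction n generalizing x with
  | zero => simp_all [Tset]
  | succ n ih =>
    obtain ⟨d, hd, y, hy, rfl⟩ := mem_Tset_succ.1 hx
    have := ih hy
    simp only [Finset.mem_insert, Finset.mem_singleton] at hd
    rw [pow_succ]
    omega

theorem exists_mem_Tset_eq (n : ℕ) : ∃ x ∈ Tset n, 8 * x + 7 = 7 * 9 ^ n := by
  induction n with
  | zero => exact ⟨0, by simp [Tset], rfl⟩
  | succ n ih =>
    obtain ⟨x, hx, h⟩ := ih
    refine ⟨7 + 9 * x, mem_Tset_succ.2 ⟨7, by simp, x, hx, rfl⟩, ?_⟩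
    rw [pow_succ]
    omega

theorem Tset_succ_gap {n x : ℕ} (hx : x ∈ Tset (n + 1)) :
    8 * x + 7 ≤ 15 * 9 ^ n ∨ 6 * 9 ^ n ≤ x := by
  induction n generalizing x with
  | zero =>
    obtain ⟨d, hd, y, hy, rfl⟩ := mem_Tset_succ.1 hx
    simp only [Tset, Finset.mem_insert, Finset.mem_singleton] at hd hy
    omega
  | succ n ih =>
    obtain ⟨d, hd, y, hy, rfl⟩ := mem_Tset_succ.1 hx
    have := ih hy
    simp only [Finset.mem_insert, Finset.mem_singleton] at hd
    rw [pow_succ]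
    omega

theorem eight_mul_sum_alternating_three_pow (n : ℕ) :
    8 * (∑ i ∈ Finset.range (2 * n), (if i % 2 = 0 then 1 else 2) * 3 ^ i) + 7 = 7 * 9 ^ n := by
  induction n with
  | zero => rfl
  | succ n ih =>
    have h : (3 : ℕ) ^ (2 * n) = 9 ^ n := by rw [pow_mul]; norm_num
    rw [show 2 * (n + 1) = 2 * n + 1 + 1 by ring, Finset.sum_range_succ, Finset.sum_range_succ,
      if_pos (by omega), if_neg (by omega), pow_succ 3, h, pow_succ 9]
    omega

theorem Tset_structure (n : ℕ) (hn : 1 ≤ n) :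
    (∃ h : (Tset n).Nonempty, (Tset n).max' h = 7 * (9 ^ n - 1) / 8) ∧
    7 * (9 ^ n - 1) / 8
      = ∑ i ∈ Finset.range (2 * n), (if i % 2 = 0 then 1 else 2) * 3 ^ i ∧
    ∀ x ∈ Tset n,
      ¬(7 * (9 ^ n - 1) / 8 - 2 * 3 ^ (2 * n - 1) < x ∧ x < 2 * 3 ^ (2 * n - 1)) := by
  obtain ⟨m, hm, hm_eq⟩ := exists_mem_Tset_eq n
  have h_max : 7 * (9 ^ n - 1) / 8 = m := by omega
  rw [h_max]
  refine ⟨⟨⟨m, hm⟩, ?_⟩, ?_, ?_⟩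
  · refine (Finset.max'_eq_iff _ _ _).2 ⟨hm, fun x hx => ?_⟩
    have := Tset_le hx
    omega
  · have := eight_mul_sum_alternating_three_pow n
    omega
  · rintro x hx ⟨h_lower, h_upper⟩
    obtain ⟨k, rfl⟩ := Nat.exists_eq_add_of_le' hn
    have h_pow : (3 : ℕ) ^ (2 * (k + 1) - 1) = 3 * 9 ^ k := by
      rw [show 2 * (k + 1) - 1 = 2 * k + 1 by omega, pow_succ, pow_mul]
      norm_num [mul_comm]
    have := Tset_succ_gap hx
    rw [h_pow] at h_lower h_upper
    rw [pow_succ] at hm_eq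
    omega
end
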